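/- arXiv:2404.00542 — 2 statements merged into one kernel-verified Lean document; each statement's English description precedes it below -/
import Mathlib

section
/- Let X̄ and Ȳ be metrizable compactifications of Tychonoff spaces X and Y, and let H ⊆ X̄ be a σ-compact subspace containing X. Suppose E(H) is a QS-algebra on H satisfying condition (2.3), and set E(X) = { f̄|X : f̄ ∈ E(H) }. Suppose E(Y) ⊆ C(Y) is a family such that every g ∈ E(Y) extends to a continuous map ḡ: Ȳ → [−∞, ∞], and the family E(Ȳ) = { ḡ : g ∈ E(Y) } contains a QS-algebra on Ȳ. Let φ: E_p(X) → E_p(Y) be a uniformly continuous surjection that is c-good for some c > 0. If 𝒫 is a property of σ-compact metrizable spaces satisfying conditions (a)–(c) and all finite powers of H have the property 𝒫, then there exists a σ-compact set Y_∞ ⊆ Ȳ containing Y such that all finite powers of Y_∞ have the property 𝒫. -/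
open Set Topology TopologicalSpace

universe u

/-- A QS-algebra on `X`: a family of continuous functions closed under sums, products and
rational scalar multiples, which separates points from closed sets in the strong sense (ii). -/
def IsQSAlgebra {X : Type*} [TopologicalSpace X] (E : Set (X → ℝ)) : Prop :=
  (∀ f ∈ E, Continuous f) ∧
  (∀ f ∈ E, ∀ g ∈ E, f + g ∈ E ∧ f * g ∈ E) ∧
  (∀ f ∈ E, ∀ q : ℚ, (q : ℝ) • f ∈ E) ∧
  (∀ x : X, ∀ U ∈ nhds x, ∃ f ∈ E, f x = 1 ∧ ∀ y ∉ U, f y = 0)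

/-- Condition (2.3) for a family of functions on `X`. -/
def SatisfiesCond23 {X : Type*} [TopologicalSpace X] (E : Set (X → ℝ)) : Prop :=
  ∀ K : Set X, IsCompact K → ∀ W : Set X, IsOpen W → K ⊆ W →
    ∃ f ∈ E, (∀ x ∈ K, f x = 1) ∧ (∀ x ∉ W, f x = 0) ∧ ∀ x, f x ∈ Set.Icc (0 : ℝ) 1

/-- Uniform continuity of a map between function spaces with the pointwise topology. -/
def IsUnifContPt {X Y : Type*} (EX : Set (X → ℝ)) (EY : Set (Y → ℝ))
    (φ : EX → EY) : Prop :=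
  ∀ U ∈ nhds (0 : Y → ℝ), ∃ V ∈ nhds (0 : X → ℝ),
    ∀ f g : EX, (f : X → ℝ) - g ∈ V → (φ f : Y → ℝ) - φ g ∈ U

noncomputable def supNorm {X : Type*} (f : X → ℝ) : ℝ := ⨆ x, |f x|

def IsCGood {X Y : Type*} {EX : Set (X → ℝ)} {EY : Set (Y → ℝ)}
    (c : ℝ) (φ : EX → EY) : Prop :=
  ∀ g : EY, (∃ M, ∀ y, |(g : Y → ℝ) y| ≤ M) →
    ∃ f : EX, φ f = g ∧ (∃ M, ∀ x, |(f : X → ℝ) x| ≤ M) ∧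
      supNorm (f : X → ℝ) ≤ c * supNorm (g : Y → ℝ)


section Decomposition

variable {H Z : Type*} [TopologicalSpace H] [TopologicalSpace Z]

/-- A compact set carrying a continuous map with countable fibers into a finite power of `H`. -/
def IsPiece (H : Type*) {Z : Type*} [TopologicalSpace H] [TopologicalSpace Z] (D : Set Z) : Prop :=
  IsCompact D ∧ ∃ (p : ℕ) (s : D → Fin p → H), Continuous s ∧ ∀ x, (s ⁻¹' {x}).Countable

theorem isPiece_image_fst [T2Space Z] {p : ℕ} {C : Set (Z × (Fin p → H))} (hC : IsCompact C)
    (hinj : InjOn Prod.fst C) (hfib : ∀ x, {z | (z, x) ∈ C}.Countable) :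
    IsPiece H (Prod.fst '' C) := by
  have : CompactSpace C := isCompact_iff_compactSpace.1 hC
  let e : C ≃ Prod.fst '' C := Equiv.Set.imageOfInjOn _ _ hinj
  have he : Continuous e :=
    Continuous.subtype_mk (continuous_fst.comp continuous_subtype_val) _
  let h := Continuous.homeoOfEquivCompactToT2 (f := e) he
  have hval (d : Prod.fst '' C) : (h.symm d : Z × (Fin p → H)).1 = d :=
    congrArg Subtype.val (e.apply_symm_apply d)
  refine ⟨hC.image continuous_fst, p, fun d ↦ (h.symm d : Z × (Fin p → H)).2,
    continuous_snd.comp (continuous_subtype_val.comp h.symm.continuous), fun x ↦ ?_⟩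
  refine MapsTo.countable_of_injOn (f := Subtype.val) (t := {z | (z, x) ∈ C}) ?_
    Subtype.val_injective.injOn (hfib x)
  rintro d rfl
  show ((d : Z), (h.symm d : Z × (Fin p → H)).2) ∈ C
  rw [← hval d]
  exact (h.symm d).2

theorem exists_isPiece_cover [T3Space H] [SecondCountableTopology H] [SigmaCompactSpace H]
    [CompactSpace Z] [T2Space Z] [SecondCountableTopology Z]
    (R : ℕ → Set H → Z → Prop)
    (hclosed : ∀ r p, IsClosed {w : Z × (Fin p → H) | R r (range w.2) w.1})
    (hinter : ∀ r K L z, K.Finite → L.Finite → R r K z → R r L z → R (r + r) (K ∩ L) z)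
    (hfib : ∀ r p (x : Fin p → H), {z | R r (range x) z}.Countable) :
    ∃ D : ℕ → Set Z, (∀ n, IsPiece H (D n)) ∧
      ∀ r K z, K.Finite → R r K z → ∃ n, z ∈ D n := by
  let L (p r k : ℕ) : Set Z := ⋃ m ∈ Iio p, Prod.fst ''
    ({w : Z × (Fin m → H) | R (r + r) (range w.2) w.1} ∩
      univ ×ˢ univ.pi fun _ ↦ compactCovering H k)
  have hcov (m k : ℕ) : IsCompact ((univ : Set Z) ×ˢ univ.pi fun _ : Fin m ↦ compactCovering H k) :=
    isCompact_univ.prod (isCompact_univ_pi fun _ ↦ isCompact_compactCovering H k)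
  have hL (p r k : ℕ) : IsClosed (L p r k) := by
    refine (finite_Iio p).isClosed_biUnion fun m _ ↦ IsCompact.isClosed ?_
    exact ((hcov m k).inter_left (hclosed _ _)).image continuous_fst
  let ι := Σ p : ℕ, ℕ × ℕ × countableBasis Z × (Fin p → countableBasis H)
  let C (i : ι) : Set (Z × (Fin i.1 → H)) :=
    {w | R i.2.1 (range w.2) w.1} ∩
      (univ ×ˢ univ.pi fun _ ↦ compactCovering H i.2.2.1) ∩
      (closure i.2.2.2.1 ×ˢ univ.pi fun j ↦ closure (i.2.2.2.2 j)) ∩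
      {_w | Disjoint (closure (i.2.2.2.1 : Set Z)) (L i.1 i.2.1 i.2.2.1) ∧
        Pairwise fun j l ↦ Disjoint (closure (i.2.2.2.2 j : Set H)) (closure (i.2.2.2.2 l))}
  have hC (i : ι) : IsCompact (C i) := by
    refine (((hcov _ _).inter_left (hclosed _ _)).inter_right
      (isClosed_closure.prod (isClosed_set_pi fun _ _ ↦ isClosed_closure))).inter_right ?_
    exact isClosed_const
  have hinj (i : ι) : InjOn Prod.fst (C i) := by
    rintro ⟨z, x⟩ ⟨⟨⟨hx, -, hxk⟩, hz, hxb⟩, hd, hp⟩ ⟨z', x'⟩ ⟨⟨⟨hx', -, -⟩, -, hxb'⟩, -, -⟩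
      (rfl : z = z')
    refine Prod.ext rfl (funext fun j ↦ ?_)
    have hmem : x j ∈ range x' := by
      by_contra hj
      have hfin := (finite_range x).inter_of_left (range x')
      obtain ⟨m, y, hy, hyr⟩ := hfin.fin_param
      have hm : m < i.1 := by
        have h1 : (range x ∩ range x').ncard < (range x).ncard :=
          ncard_lt_ncard ⟨inter_subset_left, fun h ↦ hj (h (mem_range_self j)).2⟩ (finite_range x)
        have h2 : (range x).ncard ≤ i.1 := by
          rw [← image_univ]
          simpa [ncard_univ] using ncard_image_le (f := x) (finite_univ)
        have h3 : (range y).ncard = m := by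
          rw [← image_univ, ncard_image_of_injective _ hy]
          simp [ncard_univ]
        rw [← hyr] at h1
        omega
      refine disjoint_left.1 hd hz (mem_biUnion (x := m) hm ⟨(z, y), ⟨?_, mem_univ _, ?_⟩, rfl⟩)
      · show R _ (range y) z
        rw [hyr]
        exact hinter _ _ _ _ (finite_range x) (finite_range x') hx hx'
      · intro l _
        obtain ⟨j', hj'⟩ := (hyr ▸ mem_range_self l : y l ∈ range x ∩ range x').1
        show y l ∈ _
        rw [← hj']
        exact hxk j' (mem_univ _)
    obtain ⟨l, hl⟩ := hmem
    by_cases hjl : j = l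
    · exact hl.symm.trans (congrArg x' hjl.symm)
    · have hxl : x j ∈ closure (i.2.2.2.2 l : Set H) := hl ▸ hxb' l (mem_univ l)
      exact (disjoint_left.1 (hp hjl) (hxb j (mem_univ _)) hxl).elim
  have hpiece (i : ι) : IsPiece H (Prod.fst '' C i) :=
    isPiece_image_fst (hC i) (hinj i) fun x ↦ (hfib i.2.1 i.1 x).mono fun z hz ↦ hz.1.1.1
  have hcover : ∀ r K z, K.Finite → R r K z → ∃ i, z ∈ Prod.fst '' C i := by
    intro r₀ K₀ z hK₀ hR₀
    classical
    have hex : ∃ p, ∃ x : Fin p → H, ∃ r, R r (range x) z := by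
      obtain ⟨m, y, -, rfl⟩ := hK₀.fin_param
      exact ⟨m, y, r₀, hR₀⟩
    obtain ⟨x, r, hx⟩ := Nat.find_spec hex
    have hmin {m : ℕ} (hm : m < Nat.find hex) (y : Fin m → H) (s : ℕ) : ¬ R s (range y) z :=
      fun h ↦ Nat.find_min hex hm ⟨y, s, h⟩
    generalize Nat.find hex = p at x hx hmin
    have hxinj : Function.Injective x := by
      by_contra hni
      obtain ⟨m, y, hy, hyr⟩ := (finite_range x).fin_param
      refine hmin (m := m) ?_ y r (hyr ▸ hx)
      have h1 : (range y).ncard = m := by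
        rw [← image_univ, ncard_image_of_injective _ hy]
        simp [ncard_univ]
      have h2 : (range x).ncard ≤ p := by
        rw [← image_univ]
        simpa [ncard_univ] using ncard_image_le (f := x) (finite_univ)
      have h3 : (range x).ncard ≠ p := by
        intro h
        refine hni (injOn_univ.1 (injOn_of_ncard_image_eq ?_ finite_univ))
        rw [image_univ, h]
        simp [ncard_univ]
      rw [← hyr] at h2 h3
      omega
    choose k hk using fun j ↦ exists_mem_compactCovering (x j)
    let k' := Finset.univ.sup k
    have hk' (j) : x j ∈ compactCovering H k' :=
      compactCovering_subset H (Finset.le_sup (Finset.mem_univ j)) (hk j)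
    obtain ⟨U, hU, hUd⟩ := (finite_range x).t2_separation
    choose b hb hxb hbU using fun j ↦ (isBasis_countableBasis H).exists_closure_subset
      ((hU (x j)).2.mem_nhds (hU (x j)).1)
    have hzL : z ∉ L p r k' := by
      intro h
      obtain ⟨m, hm, ⟨z', y⟩, ⟨hy, -⟩, rfl⟩ := mem_iUnion₂.1 h
      exact hmin hm y _ hy
    obtain ⟨b₀, hb₀, hzb₀, hb₀L⟩ := (isBasis_countableBasis Z).exists_closure_subset
      ((hL p r k').isOpen_compl.mem_nhds hzL)
    refine ⟨⟨p, r, k', ⟨b₀, hb₀⟩, fun j ↦ ⟨b j, hb j⟩⟩, (z, x),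
      ⟨⟨⟨hx, mem_univ _, fun j _ ↦ hk' j⟩, subset_closure hzb₀,
        fun j _ ↦ subset_closure (hxb j)⟩, ?_, fun j l hjl ↦ ?_⟩, rfl⟩
    · exact disjoint_left.2 hb₀L
    · exact (hUd (mem_range_self j) (mem_range_self l) (hxinj.ne hjl)).mono (hbU j) (hbU l)
  rcases isEmpty_or_nonempty ι with hι | hι
  · refine ⟨fun _ ↦ ∅, fun _ ↦ ⟨isCompact_empty, 0, fun _ ↦ Fin.elim0, ?_, fun _ ↦ ?_⟩,
      fun r K z hK hR ↦ isEmptyElim (hcover r K z hK hR).choose⟩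
    · exact continuous_const
    · exact (Set.toFinite _).countable
  · obtain ⟨e, he⟩ := exists_surjective_nat ι
    refine ⟨fun n ↦ Prod.fst '' C (e n), fun n ↦ hpiece _, fun r K z hK hR ↦ ?_⟩
    obtain ⟨i, hi⟩ := hcover r K z hK hR
    obtain ⟨n, rfl⟩ := he i
    exact ⟨n, hi⟩

end Decomposition

section Powers

theorem property_pi_of_isPiece {H Z : Type u} [TopologicalSpace H] [MetrizableSpace H]
    [SigmaCompactSpace H] [TopologicalSpace Z] [MetrizableSpace Z]
    (P : ∀ (Z : Type u) [TopologicalSpace Z], Prop)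
    (hb : ∀ (Z : Type u) [TopologicalSpace Z] [MetrizableSpace Z] [SigmaCompactSpace Z],
      ∀ F : ℕ → Set Z, (∀ n, IsClosed (F n)) → (∀ n, P ↥(F n)) → (⋃ n, F n) = Set.univ →
        P Z)
    (hcc : ∀ (Z W : Type u) [TopologicalSpace Z] [TopologicalSpace W]
      [MetrizableSpace Z] [SigmaCompactSpace Z] [MetrizableSpace W] [SigmaCompactSpace W],
      ∀ f : Z → W, Continuous f → IsClosedMap f → (∀ w, IsCompact (f ⁻¹' {w})) →
        (∀ w, (f ⁻¹' {w}).Countable) → P W → P Z)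
    (hHP : ∀ n : ℕ, P (Fin n → H))
    (D : ℕ → Set Z) (hD : ∀ n, IsPiece H (D n)) (n : ℕ) :
    P (Fin n → ↥(⋃ k, D k)) := by
  have : SigmaCompactSpace ↥(⋃ k, D k) := isSigmaCompact_iff_sigmaCompactSpace.1
    (isSigmaCompact_iUnion_of_isCompact D fun k ↦ (hD k).1)
  obtain ⟨e, he⟩ := exists_surjective_nat (Fin n → ℕ)
  let T (m : Fin n → ℕ) : Set (Fin n → ↥(⋃ k, D k)) :=
    univ.pi fun i ↦ Subtype.val ⁻¹' D (m i)
  have hT (m) : IsCompact (T m) := isCompact_univ_pi fun i ↦ by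
    rw [Subtype.isCompact_iff, Subtype.image_preimage_coe,
      inter_eq_right.2 (subset_iUnion D (m i))]
    exact (hD (m i)).1
  refine hb _ (fun k ↦ T (e k)) (fun k ↦ (hT _).isClosed) (fun k ↦ ?_) ?_
  · generalize e k = m
    choose p s hs hfib using fun i ↦ (hD (m i)).2
    have : CompactSpace (T m) := isCompact_iff_compactSpace.1 (hT m)
    let f (y : T m) : Fin (∑ i, p i) → H := fun j ↦
      s (finSigmaFinEquiv.symm j).1 ⟨y.1 (finSigmaFinEquiv.symm j).1, y.2 _ (mem_univ _)⟩
        (finSigmaFinEquiv.symm j).2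
    have hf : Continuous f := by
      refine continuous_pi fun j ↦ (continuous_apply _).comp ((hs _).comp ?_)
      exact Continuous.subtype_mk (continuous_subtype_val.comp
        ((continuous_apply _).comp continuous_subtype_val)) _
    refine hcc (T m) (Fin (∑ i, p i) → H) f hf hf.isClosedMap
      (fun w ↦ (isClosed_singleton.preimage hf).isCompact) (fun w ↦ ?_) (hHP _)
    have hc : (univ.pi fun i ↦ s i ⁻¹' {fun l ↦ w (finSigmaFinEquiv ⟨i, l⟩)}).Countable :=
      countable_univ_pi fun i ↦ hfib i _
    refine MapsTo.countable_of_injOn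
      (f := fun (y : T m) (i : Fin n) ↦ (⟨y.1 i, y.2 i (mem_univ i)⟩ : D (m i)))
      ?_ ?_ hc
    · rintro y rfl i -
      refine funext fun l ↦ ?_
      simp only [f]
      rw [Equiv.symm_apply_apply]
    · intro y _ y' _ h
      refine Subtype.ext (funext fun i ↦ Subtype.ext ?_)
      exact congrArg (fun d : D (m i) ↦ (d : Z)) (congrFun h i)
  · refine eq_univ_of_forall fun y ↦ ?_
    choose m hm using fun i ↦ mem_iUnion.1 (y i).2
    obtain ⟨k, rfl⟩ := he m
    exact mem_iUnion.2 ⟨k, fun i _ ↦ hm i⟩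

end Powers

section Controls

/-- Extended reals at distance at most `r`; infinite values are near only to themselves. -/
def ERealNear (r : ℕ) (s t : EReal) : Prop :=
  s ≤ t + ((r : ℝ) : EReal) ∧ t ≤ s + ((r : ℝ) : EReal)

theorem ERealNear.trans {r q : ℕ} {s t u : EReal} (h : ERealNear r s t) (h' : ERealNear q t u) :
    ERealNear (r + q) s u := by
  unfold ERealNear at *
  push_cast
  constructor
  · calc s ≤ t + ((r : ℝ) : EReal) := h.1
      _ ≤ u + ((q : ℝ) : EReal) + ((r : ℝ) : EReal) := add_le_add_left h'.1 _
      _ = _ := by rw [add_assoc, add_comm ((q : ℝ) : EReal)]; push_cast; rfl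
  · calc u ≤ t + ((q : ℝ) : EReal) := h'.2
      _ ≤ s + ((r : ℝ) : EReal) + ((q : ℝ) : EReal) := add_le_add_left h.2 _
      _ = _ := by rw [add_assoc]; push_cast; rfl

theorem eRealNear_coe {r : ℕ} {a b : ℝ} : ERealNear r a b ↔ |a - b| ≤ r := by
  unfold ERealNear
  rw [← EReal.coe_add, ← EReal.coe_add, EReal.coe_le_coe_iff, EReal.coe_le_coe_iff, abs_le]
  constructor <;> rintro ⟨h₁, h₂⟩ <;> constructor <;> linarith

theorem isClosed_setOf_eRealNear {W : Type*} [TopologicalSpace W] (r : ℕ) {s t : W → EReal}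
    (hs : Continuous s) (ht : Continuous t) : IsClosed {w | ERealNear r (s w) (t w)} := by
  have hadd : Continuous fun a : EReal ↦ a + ((r : ℝ) : EReal) :=
    continuous_iff_continuousAt.2 fun a ↦
      (EReal.continuousAt_add (p := (a, ((r : ℝ) : EReal))) (.inr (EReal.coe_ne_bot _))
        (.inr (EReal.coe_ne_top _))).comp
        (f := fun a : EReal ↦ (a, ((r : ℝ) : EReal))) (by fun_prop)
  exact (isClosed_le hs (hadd.comp ht)).inter (isClosed_le ht (hadd.comp hs))

variable {H Z : Type*}

/-- The values at `z` of `α f` and `α g` differ by at most `r` whenever `f` and `g` differ by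
less than `1` on `K`. -/
def Controls {E : Set (H → ℝ)} (α : E → Z → EReal) (r : ℕ) (K : Set H) (z : Z) : Prop :=
  ∀ f g : E, (∀ x ∈ K, |f.1 x - g.1 x| < 1) → ERealNear r (α f z) (α g z)

variable [TopologicalSpace H] {E : Set (H → ℝ)} {α : E → Z → EReal}

theorem isClosed_setOf_controls [TopologicalSpace Z] (hE : ∀ f ∈ E, Continuous f) (hα : ∀ f, Continuous (α f))
    (r p : ℕ) : IsClosed {w : Z × (Fin p → H) | Controls α r (range w.2) w.1} := by
  simp only [Controls, ofPred_forall, forall_mem_range]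
  refine isClosed_iInter fun f ↦ isClosed_iInter fun g ↦ isClosed_imp ?_ ?_
  · simp only [ofPred_forall]
    refine isOpen_iInter_of_finite fun i ↦ isOpen_lt ?_ continuous_const
    have hf := hE f f.2
    have hg := hE g g.2
    fun_prop
  · exact isClosed_setOf_eRealNear r ((hα f).comp continuous_fst) ((hα g).comp continuous_fst)

theorem Controls.inter [T1Space H] (hE : IsQSAlgebra E) (hE' : SatisfiesCond23 E) {r q : ℕ}
    {K L : Set H} {z : Z} (hK : K.Finite) (hL : L.Finite) (h : Controls α r K z)
    (h' : Controls α q L z) : Controls α (r + q) (K ∩ L) z := by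
  intro f g hfg
  obtain ⟨e, he, heK, heL, -⟩ := hE' K hK.isCompact (L \ K)ᶜ hL.sdiff.isClosed.isOpen_compl
    fun x hx hx' ↦ hx'.2 hx
  have hm : g.1 + e * (f.1 + ((-1 : ℚ) : ℝ) • g.1) ∈ E :=
    (hE.2.1 _ g.2 _ (hE.2.1 _ he _ (hE.2.1 _ f.2 _ (hE.2.2.1 _ g.2 _)).1).2).1
  refine (h f ⟨_, hm⟩ fun x hx ↦ ?_).trans (h' ⟨_, hm⟩ g fun x hx ↦ ?_)
  · simp [heK x hx]
  · by_cases hxK : x ∈ K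
    · simpa [heK x hxK] using hfg x ⟨hxK, hx⟩
    · simp [heL x (fun h ↦ h ⟨hx, hxK⟩)]

end Controls

section Density

variable {Z : Type*} [TopologicalSpace Z] [CompactSpace Z] {Γ : Set (Z → ℝ)}

theorem IsQSAlgebra.exists_pos [Nonempty Z] (hΓ : IsQSAlgebra Γ) : ∃ u ∈ Γ, ∀ z, 0 < u z := by
  suffices h : ∃ u ∈ Γ, (∀ z, 0 ≤ u z) ∧ ∀ z ∈ (univ : Set Z), 0 < u z by
    obtain ⟨u, hu, -, hpos⟩ := h
    exact ⟨u, hu, fun z ↦ hpos z (mem_univ z)⟩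
  refine isCompact_univ.induction_on (p := fun s ↦ ∃ u ∈ Γ, (∀ z, 0 ≤ u z) ∧ ∀ z ∈ s, 0 < u z)
    ?_ ?_ ?_ ?_
  · obtain ⟨f, hf, -⟩ := hΓ.2.2.2 (Classical.arbitrary Z) univ Filter.univ_mem
    exact ⟨_, hΓ.2.2.1 f hf 0, by simp, by simp⟩
  · rintro s t hst ⟨u, hu, h0, hpos⟩
    exact ⟨u, hu, h0, fun z hz ↦ hpos z (hst hz)⟩
  · rintro s t ⟨u, hu, hu0, hupos⟩ ⟨v, hv, hv0, hvpos⟩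
    refine ⟨u + v, (hΓ.2.1 u hu v hv).1, fun z ↦ add_nonneg (hu0 z) (hv0 z), ?_⟩
    rintro z (hz | hz)
    · exact add_pos_of_pos_of_nonneg (hupos z hz) (hv0 z)
    · exact add_pos_of_nonneg_of_pos (hu0 z) (hvpos z hz)
  · intro z _
    obtain ⟨f, hf, hfz, -⟩ := hΓ.2.2.2 z univ Filter.univ_mem
    refine ⟨{w | f w ≠ 0}, mem_nhdsWithin_of_mem_nhds ?_, f * f, (hΓ.2.1 f hf f hf).2,
      fun w ↦ mul_self_nonneg _, fun w hw ↦ mul_self_pos.2 hw⟩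
    exact (hΓ.1 f hf).continuousAt.eventually_ne (by simp [hfz])

theorem IsQSAlgebra.one_mem_closure [Nonempty Z] (hΓ : IsQSAlgebra Γ) :
    (1 : C(Z, ℝ)) ∈ closure {h : C(Z, ℝ) | ⇑h ∈ Γ} := by
  obtain ⟨u, hu, hpos⟩ := hΓ.exists_pos
  let u' : C(Z, ℝ) := ⟨u, hΓ.1 u hu⟩
  obtain ⟨N, hN⟩ := exists_nat_gt ‖u'‖
  have hN0 : (0 : ℝ) < N := (norm_nonneg _).trans_lt hN
  let v : C(Z, ℝ) := ((N : ℝ)⁻¹) • u'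
  have hv : ⇑v ∈ Γ := by
    have := hΓ.2.2.1 u hu (N : ℚ)⁻¹
    push_cast at this
    exact this
  have hnorm : ‖1 - v‖ < 1 := by
    rw [ContinuousMap.norm_lt_iff _ one_pos]
    intro z
    have h1 : u z < N := lt_of_le_of_lt ((le_abs_self _).trans (u'.norm_coe_le_norm z)) hN
    have h2 : (N : ℝ)⁻¹ * u z < 1 := by
      rw [inv_mul_lt_iff₀ hN0]; simpa using h1
    have h3 : 0 < (N : ℝ)⁻¹ * u z := mul_pos (inv_pos.2 hN0) (hpos z)
    show |1 - (N : ℝ)⁻¹ * u z| < 1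
    rw [abs_lt]
    constructor <;> linarith
  have hmem (n : ℕ) : ⇑(1 - (1 - v) ^ (n + 1)) ∈ Γ := by
    induction n with
    | zero => simpa using hv
    | succ n ih =>
      have h := (hΓ.2.1 _ ih _ (hΓ.2.1 _ hv _ (hΓ.2.2.1 _ (hΓ.2.1 _ hv _ ih).2 (-1))).1).1
      convert h using 1
      ext z
      simp
      ring
  have hlim : Filter.Tendsto (fun n : ℕ ↦ 1 - (1 - v) ^ (n + 1)) Filter.atTop (nhds 1) := by
    have h := (tendsto_pow_atTop_nhds_zero_of_norm_lt_one hnorm).comp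
      (Filter.tendsto_add_atTop_nat 1)
    simpa using h.const_sub 1
  exact mem_closure_of_tendsto hlim (Filter.Eventually.of_forall hmem)

theorem IsQSAlgebra.dense [T2Space Z] [Nonempty Z] (hΓ : IsQSAlgebra Γ) :
    Dense {h : C(Z, ℝ) | ⇑h ∈ Γ} := by
  set G := {h : C(Z, ℝ) | ⇑h ∈ Γ}
  have hsmul (r : ℝ) {f : C(Z, ℝ)} (hf : f ∈ closure G) : r • f ∈ closure G :=
    map_mem_closure₂ (f := fun (r : ℝ) (f : C(Z, ℝ)) ↦ r • f) (s := range ((↑) : ℚ → ℝ))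
      continuous_smul (Rat.denseRange_cast r) hf (by
        rintro _ ⟨q, rfl⟩ f hf
        exact hΓ.2.2.1 f hf q)
  have hadd {f g : C(Z, ℝ)} (hf : f ∈ closure G) (hg : g ∈ closure G) : f + g ∈ closure G :=
    map_mem_closure₂ continuous_add hf hg fun f hf g hg ↦ (hΓ.2.1 f hf g hg).1
  have hmul {f g : C(Z, ℝ)} (hf : f ∈ closure G) (hg : g ∈ closure G) : f * g ∈ closure G :=
    map_mem_closure₂ continuous_mul hf hg fun f hf g hg ↦ (hΓ.2.1 f hf g hg).2
  have hle : (Algebra.adjoin ℝ G : Set C(Z, ℝ)) ⊆ closure G := fun f hf ↦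
    Algebra.adjoin_induction (fun f hf ↦ subset_closure hf)
      (fun r ↦ by rw [Algebra.algebraMap_eq_smul_one]; exact hsmul r hΓ.one_mem_closure)
      (fun f g _ _ hf hg ↦ hadd hf hg) (fun f g _ _ hf hg ↦ hmul hf hg) hf
  have hsep : (Algebra.adjoin ℝ G).SeparatesPoints := by
    intro y z hyz
    obtain ⟨f, hf, hfy, hfz⟩ := hΓ.2.2.2 y {z}ᶜ (isOpen_compl_singleton.mem_nhds hyz)
    refine ⟨f, ⟨⟨f, hΓ.1 f hf⟩, Algebra.subset_adjoin hf, rfl⟩, ?_⟩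
    rw [hfy, hfz z (by simp)]
    exact one_ne_zero
  have htop := ContinuousMap.subalgebra_topologicalClosure_eq_top_of_separatesPoints _ hsep
  intro f
  have hf : f ∈ (Algebra.adjoin ℝ G).topologicalClosure := htop ▸ Algebra.mem_top
  exact closure_minimal hle isClosed_closure hf

theorem finite_setOf_controls {H : Type*} [T2Space Z] (hΓ : IsQSAlgebra Γ) {E : Set (H → ℝ)}
    {α : E → Z → EReal} {c : ℝ}
    (hgood : ∀ h ∈ Γ, ∀ M, 0 ≤ M → (∀ z, |h z| ≤ M) →
      ∃ f : E, (∀ x, |f.1 x| ≤ c * M) ∧ ∀ z, α f z = h z)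
    (r p : ℕ) (x : Fin p → H) : {z | Controls α r (range x) z}.Finite := by
  classical
  by_contra hinf
  let R : ℝ := c * (r + 3)
  let B : Finset (Fin p → ℤ) := Fintype.piFinset fun _ ↦ Finset.Icc ⌊-R⌋ ⌊R⌋
  obtain ⟨T, hT, hcard⟩ := Set.Infinite.exists_subset_card_eq hinf (B.card + 1)
  have hex (z : Z) (hz : z ∈ T) : ∃ h ∈ Γ, (∀ w, |h w| ≤ r + 3) ∧ r + 3 / 2 < h z ∧
      ∀ w ∈ T, w ≠ z → h w < 1 / 2 := by
    have : Nonempty Z := ⟨z⟩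
    obtain ⟨k, hk0, hk1, hk⟩ := exists_continuous_zero_one_of_isClosed
      (s := ((T.erase z : Finset Z) : Set Z)) (t := {z})
      (T.erase z).finite_toSet.isClosed isClosed_singleton (by simp)
    obtain ⟨h, hh, hd⟩ := hΓ.dense.exists_dist_lt (((r : ℝ) + 2) • k) (ε := 1 / 2) (by norm_num)
    have hd' (w : Z) : |(r + 2) * k w - h w| < 1 / 2 :=
      (ContinuousMap.dist_apply_le_dist (f := ((r : ℝ) + 2) • k) (g := h) w).trans_lt hd
    refine ⟨h, hh, fun w ↦ ?_, ?_, fun w hw hwz ↦ ?_⟩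
    · have h1 := abs_lt.1 (hd' w)
      have h2 : 0 ≤ (r + 2) * k w := mul_nonneg (by positivity) (hk w).1
      have h3 : (r + 2) * k w ≤ (r + 2) * 1 :=
        mul_le_mul_of_nonneg_left (hk w).2 (by positivity)
      rw [abs_le]
      constructor <;> linarith
    · have h1 := abs_lt.1 (hd' z)
      rw [hk1 rfl, Pi.one_apply] at h1
      linarith
    · have h1 := abs_lt.1 (hd' w)
      rw [hk0 (by simp [hw, hwz]), Pi.zero_apply] at h1
      linarith
  choose! h hΓh hbd hz hzw using hex
  have hexf (z : Z) (hzT : z ∈ T) : ∃ f : E, (∀ x, |f.1 x| ≤ R) ∧ ∀ w, α f w = h z w :=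
    hgood (h z) (hΓh z hzT) (r + 3) (by positivity) (hbd z hzT)
  have : Nonempty E := by
    obtain ⟨z, hz⟩ : T.Nonempty := Finset.card_pos.1 (by omega)
    exact ⟨(hexf z hz).choose⟩
  choose! f hfR hfα using hexf
  obtain ⟨y, hy, z, hz', hyz, hfl⟩ := Finset.exists_ne_map_eq_of_card_lt_of_maps_to
    (s := T) (t := B) (f := fun z i ↦ ⌊(f z).1 (x i)⌋) (by omega) (by
      intro z hz
      refine Finset.mem_coe.2 (Fintype.mem_piFinset.2 fun i ↦ Finset.mem_Icc.2 ?_)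
      have := abs_le.1 (hfR z hz (x i))
      exact ⟨Int.floor_mono this.1, Int.floor_mono this.2⟩)
  have hnear := hT hy (f y) (f z) (by
    rintro _ ⟨i, rfl⟩
    exact Int.abs_sub_lt_one_of_floor_eq_floor (congrFun hfl i))
  rw [hfα y hy, hfα z hz', eRealNear_coe, abs_le] at hnear
  have h1 := hz y hy
  have h2 := hzw z hz' y hy hyz
  linarith [hnear.2]

end Density

section UniformContinuity

theorem IsUnifContPt.exists_finite_bound {X Y : Type*} {EX : Set (X → ℝ)} {EY : Set (Y → ℝ)}
    {φ : EX → EY} (hφ : IsUnifContPt EX EY φ)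
    (hadd : ∀ f ∈ EX, ∀ g ∈ EX, f + g ∈ EX) (hsmul : ∀ f ∈ EX, ∀ q : ℚ, (q : ℝ) • f ∈ EX)
    (y : Y) : ∃ (I : Set X) (N : ℕ), I.Finite ∧ ∀ f g : EX,
      (∀ x ∈ I, |f.1 x - g.1 x| < 1) → |(φ f).1 y - (φ g).1 y| ≤ N := by
  obtain ⟨V, hV, hVU⟩ := hφ {u | |u y| < 1} <| by
    refine IsOpen.mem_nhds (isOpen_lt (by fun_prop) continuous_const) ?_
    simp
  rw [nhds_pi, Filter.mem_pi] at hV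
  obtain ⟨I, hI, t, ht, htV⟩ := hV
  have hev (x : X) : ∀ᶠ N : ℕ in Filter.atTop, ∀ a : ℝ, |a| < 1 → a / N ∈ t x := by
    obtain ⟨ε, hε, hball⟩ := Metric.mem_nhds_iff.1 (ht x)
    obtain ⟨M, hM⟩ := exists_nat_gt (1 / ε)
    filter_upwards [Filter.eventually_ge_atTop M, Filter.eventually_gt_atTop 0] with N hN hN0 a ha
    have hN0' : (0 : ℝ) < N := by exact_mod_cast hN0
    have hMN : (M : ℝ) ≤ N := by exact_mod_cast hN
    apply hball
    rw [Pi.zero_apply, mem_ball_zero_iff, Real.norm_eq_abs, abs_div, Nat.abs_cast,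
      div_lt_iff₀ hN0']
    have h1 : 1 < M * ε := (div_lt_iff₀ hε).1 hM
    nlinarith
  obtain ⟨N, hN, hN0⟩ := (((Filter.eventually_all_finite hI).2 fun x _ ↦ hev x).and
    (Filter.eventually_gt_atTop 0)).exists
  have hN0' : (N : ℝ) ≠ 0 := by exact_mod_cast hN0.ne'
  refine ⟨I, N, hI, fun f g hfg ↦ ?_⟩
  have hmem (k : ℕ) : g.1 + ((k / N : ℚ) : ℝ) • (f.1 + ((-1 : ℚ) : ℝ) • g.1) ∈ EX :=
    hadd _ g.2 _ (hsmul _ (hadd _ f.2 _ (hsmul _ g.2 _)) _)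
  let s (k : ℕ) : EX := ⟨_, hmem k⟩
  have hstep (k : ℕ) : |(φ (s (k + 1))).1 y - (φ (s k)).1 y| < 1 := by
    refine hVU (s (k + 1)) (s k) (htV fun x hx ↦ ?_)
    have h := hN x hx _ (hfg x hx)
    convert h using 1
    simp [s]
    field_simp
    ring
  have hsum (k : ℕ) : |(φ (s k)).1 y - (φ (s 0)).1 y| ≤ k := by
    induction k with
    | zero => simp
    | succ k ih =>
      have := abs_sub_le ((φ (s (k + 1))).1 y) ((φ (s k)).1 y) ((φ (s 0)).1 y)
      push_cast
      linarith [hstep k]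
  have h0 : s 0 = g := Subtype.ext (by simp [s])
  have h1 : s N = f := Subtype.ext (by
    simp only [s]
    rw [div_self (by exact_mod_cast hN0.ne')]
    ext x
    simp)
  simpa [h0, h1] using hsum N

end UniformContinuity

theorem statement4
    -- `X` and `Y` are Tychonoff spaces
    {X Y : Type u} [TopologicalSpace X] [TopologicalSpace Y] [T35Space X] [T35Space Y]
    -- metrizable compactifications `X̄` and `Ȳ` of `X` and `Y`
    {Xbar Ybar : Type u} [TopologicalSpace Xbar] [TopologicalSpace Ybar]
    [CompactSpace Xbar] [T2Space Xbar] [MetrizableSpace Xbar]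
    [CompactSpace Ybar] [T2Space Ybar] [MetrizableSpace Ybar]
    (eX : X → Xbar) (heX : Topology.IsEmbedding eX) (hdX : DenseRange eX)
    (eY : Y → Ybar) (heY : Topology.IsEmbedding eY) (hdY : DenseRange eY)
    -- `H ⊆ X̄` is a σ-compact subspace containing `X`
    (H : Set Xbar) (hHσ : IsSigmaCompact H) (hXH : ∀ x, eX x ∈ H)
    -- `E(H)` is a QS-algebra on `H` satisfying condition (2.3)
    (EH : Set (↥H → ℝ)) (hEHqs : IsQSAlgebra EH) (hEH23 : SatisfiesCond23 EH)
    -- `E(X)` is the family of restrictions to `X` of members of `E(H)`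
    (EX : Set (X → ℝ))
    (hEX : EX = {f | ∃ g ∈ EH, ∀ x : X, f x = g ⟨eX x, hXH x⟩})
    -- `E(Y) ⊆ C(Y)`, every `g ∈ E(Y)` extends to a continuous map `ḡ : Ȳ → [-∞,∞]`
    (EY : Set (Y → ℝ)) (hEYc : ∀ g ∈ EY, Continuous g)
    (extY : (Y → ℝ) → Ybar → EReal)
    (hextY : ∀ g ∈ EY, Continuous (extY g) ∧ ∀ y, extY g (eY y) = (g y : EReal))
    -- `E(Ȳ) = {ḡ : g ∈ E(Y)}` contains a QS-algebra on `Ȳ`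
    (Γ : Set (Ybar → ℝ)) (hΓqs : IsQSAlgebra Γ)
    (hΓsub : ∀ h ∈ Γ, ∃ g ∈ EY, ∀ z, (h z : EReal) = extY g z)
    -- `φ : E_p(X) → E_p(Y)` is a uniformly continuous `c`-good surjection
    (φ : EX → EY) (hφsurj : Function.Surjective φ)
    (hφu : IsUnifContPt EX EY φ)
    (c : ℝ) (hc : 0 < c) (hφgood : IsCGood c φ)
    -- `𝒫` is a property of σ-compact metrizable spaces satisfying conditions (a)-(c)
    (P : ∀ (Z : Type u) [TopologicalSpace Z], Prop)
    (ha : ∀ (Z : Type u) [TopologicalSpace Z] [MetrizableSpace Z] [SigmaCompactSpace Z],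
      P Z → ∀ F : Set Z, IsClosed F → P ↥F)
    (hb : ∀ (Z : Type u) [TopologicalSpace Z] [MetrizableSpace Z] [SigmaCompactSpace Z],
      ∀ F : ℕ → Set Z, (∀ n, IsClosed (F n)) → (∀ n, P ↥(F n)) → (⋃ n, F n) = Set.univ →
        P Z)
    (hcc : ∀ (Z W : Type u) [TopologicalSpace Z] [TopologicalSpace W]
      [MetrizableSpace Z] [SigmaCompactSpace Z] [MetrizableSpace W] [SigmaCompactSpace W],
      ∀ f : Z → W, Continuous f → IsClosedMap f → (∀ w, IsCompact (f ⁻¹' {w})) →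
        (∀ w, (f ⁻¹' {w}).Countable) → P W → P Z)
    -- all finite powers of `H` have the property `𝒫`
    (hHP : ∀ n : ℕ, P (Fin n → ↥H)) :
    -- conclusion: a σ-compact set `Y_∞ ⊆ Ȳ` containing `Y`, all of whose
    -- finite powers have the property `𝒫`
    ∃ Yinf : Set Ybar, IsSigmaCompact Yinf ∧ (∀ y, eY y ∈ Yinf) ∧
      ∀ n : ℕ, P (Fin n → ↥Yinf) := by

  subst hEX
  have : SigmaCompactSpace H := isSigmaCompact_iff_sigmaCompactSpace.1 hHσ
  let := metrizableSpaceMetric Xbar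
  let := metrizableSpaceMetric Ybar
  let i (x : X) : H := ⟨eX x, hXH x⟩
  have hi : DenseRange i := by
    intro z
    rw [closure_subtype, ← range_comp]
    exact hdX z.1
  let res (f : EH) : {f : X → ℝ | ∃ g ∈ EH, ∀ x : X, f x = g ⟨eX x, hXH x⟩} :=
    ⟨fun x ↦ f.1 (i x), f.1, f.2, fun _ ↦ rfl⟩
  let α (f : EH) : Ybar → EReal := extY (φ (res f))
  have hα (f : EH) : Continuous (α f) := (hextY _ (φ (res f)).2).1
  have hgood : ∀ h ∈ Γ, ∀ M, 0 ≤ M → (∀ z, |h z| ≤ M) →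
      ∃ f : EH, (∀ x, |f.1 x| ≤ c * M) ∧ ∀ z, α f z = h z := by
    intro h hh M hM hhM
    obtain ⟨g, hg, hgh⟩ := hΓsub h hh
    have hgy (y : Y) : g y = h (eY y) := by
      have := hgh (eY y)
      rw [(hextY g hg).2] at this
      exact_mod_cast this.symm
    have hgM (y : Y) : |g y| ≤ M := hgy y ▸ hhM _
    obtain ⟨⟨f', f, hf, hff'⟩, hφf, ⟨B, hB⟩, hle⟩ := hφgood ⟨g, hg⟩ ⟨M, hgM⟩
    have hres : res ⟨f, hf⟩ = ⟨f', f, hf, hff'⟩ := Subtype.ext (funext fun x ↦ (hff' x).symm)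
    refine ⟨⟨f, hf⟩, fun x ↦ ?_, fun z ↦ ?_⟩
    · refine hi.induction_on (p := fun x ↦ |f x| ≤ c * M) x
        (isClosed_le (hEHqs.1 f hf).abs continuous_const) fun x ↦ ?_
      calc |f (i x)| = |f' x| := by rw [hff' x]
        _ ≤ supNorm f' := le_ciSup (f := fun x ↦ |f' x|) ⟨B, forall_mem_range.2 hB⟩ x
        _ ≤ c * supNorm g := hle
        _ ≤ c * M := mul_le_mul_of_nonneg_left (Real.iSup_le hgM hM) hc.le
    · show extY (φ (res ⟨f, hf⟩)) z = h z
      rw [hres, hφf, hgh z]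
  obtain ⟨D, hD, hcover⟩ := exists_isPiece_cover (H := H) (Z := Ybar) (Controls α)
    (isClosed_setOf_controls hEHqs.1 hα) (fun r K L z hK hL ↦ Controls.inter hEHqs hEH23 hK hL)
    fun r p x ↦ (finite_setOf_controls hΓqs hgood r p x).countable
  refine ⟨⋃ n, D n, isSigmaCompact_iUnion_of_isCompact D fun n ↦ (hD n).1, fun y ↦ ?_,
    fun n ↦ property_pi_of_isPiece P hb hcc hHP D hD n⟩
  obtain ⟨I, N, hI, hIN⟩ := hφu.exists_finite_bound
    (by
      rintro f ⟨f', hf', hf⟩ g ⟨g', hg', hg⟩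
      exact ⟨f' + g', (hEHqs.2.1 _ hf' _ hg').1, fun x ↦ by simp [hf, hg]⟩)
    (by
      rintro f ⟨f', hf', hf⟩ q
      exact ⟨(q : ℝ) • f', hEHqs.2.2.1 _ hf' q, fun x ↦ by simp [hf]⟩) y
  refine mem_iUnion.2 (hcover N (i '' I) _ (hI.image i) fun f g hfg ↦ ?_)
  simp only [α]
  rw [(hextY _ (φ (res f)).2).2, (hextY _ (φ (res g)).2).2, eRealNear_coe]
  exact hIN _ _ fun x hx ↦ hfg _ (mem_image_of_mem i hx)
end

section
/- Let X be a separable metrizable space and let E(X) be a countable subfamily of C(X). Then there exists a metrizable compactification X̄ of X such that every f ∈ E(X) extends to a continuous map f̄: X̄ → [−∞, ∞]. Moreover, if dim X = 0, then X̄ can be chosen with dim X̄ = 0. -/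
open Set Topology TopologicalSpace

universe u

def IsCozero {X : Type*} [TopologicalSpace X] (U : Set X) : Prop :=
  ∃ f : X → ℝ, Continuous f ∧ U = {x | f x ≠ 0}

/-- Covering dimension at most `0`, defined via finite functionally open (cozero) covers. -/
def CovDimLE0 (X : Type*) [TopologicalSpace X] : Prop :=
  ∀ (n : ℕ) (U : Fin n → Set X), (∀ i, IsCozero (U i)) → (⋃ i, U i) = Set.univ →
    ∃ (m : ℕ) (V : Fin m → Set X), (∀ j, IsCozero (V j)) ∧ (⋃ j, V j) = Set.univ ∧
      (∀ j, ∃ i, V j ⊆ U i) ∧ Pairwise (Function.onFun Disjoint V)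

/-- `dim X = 0`. -/
def CovDimEq0 (X : Type*) [TopologicalSpace X] : Prop :=
  Nonempty X ∧ CovDimLE0 X

/-- A metrizable compactification of `X`. -/
structure MetrizableCompactification (X : Type u) [TopologicalSpace X] where
  space : Type u
  top : TopologicalSpace space
  compact : @CompactSpace space top
  t2 : @T2Space space top
  metrizable : @MetrizableSpace space top
  emb : X → space
  isEmbedding : @Topology.IsEmbedding X space _ top emb
  denseRange : @DenseRange space top X emb

/-- A map into a countable power of `EReal` that embeds `X` yields a metrizable compactification,
the closure of its image, to which all coordinates extend and whose points they separate. -/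
theorem exists_metrizableCompactification_of_isEmbedding {X : Type u} [TopologicalSpace X]
    {S : Set (X → ℝ)} (hS : S.Countable)
    (hemb : IsEmbedding fun (x : X) (s : S) => ((s : X → ℝ) x : EReal)) :
    ∃ (K : MetrizableCompactification X) (π : S → K.space → EReal),
      (∀ s, @Continuous K.space EReal K.top _ (π s)) ∧
      (∀ s x, π s (K.emb x) = ((s : X → ℝ) x : EReal)) ∧
      ∀ y z, (∀ s, π s y = π s z) → y = z := by
  have : Countable S := hS
  set e : X → S → EReal := fun x s => ((s : X → ℝ) x : EReal)
  have hcl : IsClosed (closure (range e)) := isClosed_closure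
  have : CompactSpace (closure (range e)) := isCompact_iff_compactSpace.1 hcl.isCompact
  let e' : X → closure (range e) := fun x => ⟨e x, subset_closure (mem_range_self x)⟩
  have he' : IsEmbedding e' :=
    IsEmbedding.of_comp (hemb.continuous.subtype_mk _) continuous_subtype_val hemb
  have hd : DenseRange e' := by
    have h : DenseRange (inclusion (subset_closure (s := range e))) :=
      denseRange_inclusion_iff subset_closure |>.2 subset_rfl
    exact h.comp (rangeFactorization_surjective (f := e)).denseRange
      (continuous_inclusion subset_closure)
  refine ⟨⟨closure (range e), inferInstance, inferInstance, inferInstance, inferInstance, e', he',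
    hd⟩, fun s y => y.1 s, ?_, ?_, ?_⟩
  · exact fun s => (continuous_apply s).comp continuous_subtype_val
  · exact fun s x => rfl
  · exact fun y z h => Subtype.ext (funext h)

theorem exists_countable_isEmbedding (X : Type*) [TopologicalSpace X] [MetrizableSpace X]
    [SeparableSpace X] :
    ∃ S : Set (X → ℝ), S.Countable ∧ (∀ f ∈ S, Continuous f) ∧
      IsEmbedding fun (x : X) (s : S) => (s : X → ℝ) x := by
  let := metrizableSpaceMetric X
  obtain ⟨F, hF⟩ := Metric.PiNatEmbed.exists_embedding_to_hilbert_cube (X := X)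
  have hFc : ∀ n, Continuous fun x => (F x n : ℝ) := fun n =>
    continuous_subtype_val.comp ((continuous_apply n).comp hF.continuous)
  refine ⟨range fun n x => (F x n : ℝ), countable_range _, ?_, ?_⟩
  · rintro _ ⟨n, rfl⟩
    exact hFc n
  · have hval : IsEmbedding fun (u : ℕ → unitInterval) n => (u n : ℝ) :=
      IsEmbedding.piMap fun _ => IsEmbedding.subtypeVal
    refine IsEmbedding.of_comp (g := fun v (n : ℕ) => v ⟨_, mem_range_self n⟩) ?_ ?_ (hval.comp hF)
    · refine continuous_pi ?_
      rintro ⟨_, n, rfl⟩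
      exact hFc n
    · fun_prop

theorem Topology.IsEmbedding.coe_ereal_of_subset {X : Type*} [TopologicalSpace X] {S T : Set (X → ℝ)}
    (hS : IsEmbedding fun (x : X) (s : S) => (s : X → ℝ) x) (hST : S ⊆ T)
    (hT : ∀ f ∈ T, Continuous f) :
    IsEmbedding fun (x : X) (s : T) => ((s : X → ℝ) x : EReal) := by
  have hval : IsEmbedding fun (u : S → ℝ) s => (u s : EReal) :=
    IsEmbedding.piMap fun _ => EReal.isEmbedding_coe
  refine IsEmbedding.of_comp (g := fun v (s : S) => v ⟨s, hST s.2⟩) ?_ ?_ (hval.comp hS)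
  · exact continuous_pi fun s => continuous_coe_real_ereal.comp (hT s s.2)
  · fun_prop

theorem IsCozero.isOpen {X : Type*} [TopologicalSpace X] {U : Set X} (hU : IsCozero U) :
    IsOpen U := by
  obtain ⟨f, hf, rfl⟩ := hU
  exact isOpen_ne_fun hf continuous_const

theorem IsClopen.continuous_indicator_one {X : Type*} [TopologicalSpace X] {U : Set X}
    (hU : IsClopen U) : Continuous (U.indicator (1 : X → ℝ)) :=
  continuous_one.indicator (by simp [hU.frontier_eq])

theorem IsClopen.isCozero {X : Type*} [TopologicalSpace X] {U : Set X} (hU : IsClopen U) :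
    IsCozero U :=
  ⟨U.indicator 1, hU.continuous_indicator_one, by
    ext x; simp⟩

theorem isCozero_lt {X : Type*} [TopologicalSpace X] {f g : X → ℝ} (hf : Continuous f)
    (hg : Continuous g) : IsCozero {x | f x < g x} :=
  ⟨fun x => max (g x - f x) 0, by fun_prop, by
    ext x; simp⟩

theorem CovDimLE0.exists_isClopen_between {X : Type*} [TopologicalSpace X] (hX : CovDimLE0 X)
    {f : X → ℝ} (hf : Continuous f) {p q : ℝ} (hpq : p < q) :
    ∃ C : Set X, IsClopen C ∧ (∀ x, f x ≤ p → x ∈ C) ∧ ∀ x ∈ C, f x < q := by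
  obtain ⟨m, V, hV, hVu, hVU, hVd⟩ := hX 2 ![{x | f x < q}, {x | p < f x}]
    (by
      intro i
      fin_cases i
      · exact isCozero_lt hf continuous_const
      · exact isCozero_lt continuous_const hf)
    (by
      refine eq_univ_of_forall fun x => mem_iUnion.2 ?_
      rcases lt_or_ge (f x) q with h | h
      · exact ⟨0, h⟩
      · exact ⟨1, hpq.trans_le h⟩)
  have hcov : ∀ x, ∃ j, x ∈ V j := fun x => mem_iUnion.1 (hVu ▸ mem_univ x)
  have hcompl : (⋃ j ∈ {j | V j ⊆ {x | f x < q}}, V j)ᶜ =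
      ⋃ j ∈ {j | ¬ V j ⊆ {x | f x < q}}, V j := by
    ext x
    obtain ⟨j, hj⟩ := hcov x
    have huniq : ∀ k, x ∈ V k → k = j := fun k hk => by
      by_contra hne
      exact disjoint_left.1 (hVd hne) hk hj
    simp only [mem_compl_iff, mem_iUnion, mem_ofPred_eq, exists_prop, not_exists, not_and]
    constructor
    · exact fun h => ⟨j, fun hjq => h j hjq hj, hj⟩
    · rintro ⟨k, hk, hxk⟩ l hl hxl
      rw [huniq k hxk] at hk
      rw [huniq l hxl] at hl
      exact hk hl
  refine ⟨⋃ j ∈ {j | V j ⊆ {x | f x < q}}, V j, ⟨⟨?_⟩, ?_⟩, fun x hx => ?_, fun x hx => ?_⟩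
  · rw [hcompl]
    exact isOpen_biUnion fun j _ => (hV j).isOpen
  · exact isOpen_biUnion fun j _ => (hV j).isOpen
  · by_contra hxC
    rw [← mem_compl_iff, hcompl] at hxC
    obtain ⟨j, hj, hxj⟩ := mem_iUnion₂.1 hxC
    obtain ⟨i, hi⟩ := hVU j
    fin_cases i
    · exact hj hi
    · exact absurd (hi hxj) (not_lt.2 hx)
  · obtain ⟨j, hj, hxj⟩ := mem_iUnion₂.1 hx
    exact hj hxj

theorem CovDimLE0.of_totallySeparatedSpace (K : Type*) [TopologicalSpace K] [CompactSpace K]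
    [TotallySeparatedSpace K] : CovDimLE0 K := by
  intro n U hU hUu
  have hcov : IsOpenCover fun i => (⟨U i, (hU i).isOpen⟩ : Opens K) := by
    rw [IsOpenCover, ← SetLike.coe_set_eq]
    simpa using hUu
  obtain ⟨m, W, hW, hWu, hWd⟩ := hcov.exists_finite_nonempty_disjoint_clopen_cover
  refine ⟨m, fun j => W j, fun j => (W j).isClopen.isCozero, univ_subset_iff.1 hWu,
    fun j => (hW j).2, fun i j hij => ?_⟩
  have h := hWd hij
  rw [Function.onFun, disjoint_iff, ← SetLike.coe_set_eq] at h
  rw [Function.onFun, disjoint_iff_inter_eq_empty]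
  simpa using h

/-- If the coordinates `π` separate the points of `K` and, on a dense subset, each coordinate is an
indicator or has its sublevel sets separated by indicator coordinates, then `K` is totally
separated. -/
theorem totallySeparatedSpace_of_indicator {X K ι : Type*} [TopologicalSpace K]
    {e : X → K} (he : DenseRange e) {π : ι → K → EReal} (hπ : ∀ s, Continuous (π s))
    (hsep : ∀ y z, (∀ s, π s y = π s z) → y = z)
    (hind : ∀ s, (∀ x, π s (e x) = 0 ∨ π s (e x) = 1) ∨
      ∀ p q : ℚ, p < q → ∃ t, ∀ x,
        (π t (e x) = 0 ∧ ((p : ℝ) : EReal) ≤ π s (e x)) ∨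
        (π t (e x) = 1 ∧ π s (e x) ≤ ((q : ℝ) : EReal))) :
    TotallySeparatedSpace K := by
  have hcl : ∀ t, (∀ x, π t (e x) = 0 ∨ π t (e x) = 1) → IsClopen {y | π t y = 1} := by
    intro t ht
    have hall : ∀ y, π t y = 0 ∨ π t y = 1 := fun y =>
      he.induction_on y ((isClosed_eq (hπ t) continuous_const).union
        (isClosed_eq (hπ t) continuous_const)) ht
    have hcompl : {y | π t y = 1}ᶜ = {y | π t y = 0} := by
      ext y
      rcases hall y with h | h <;> simp [h]
    refine ⟨isClosed_eq (hπ t) continuous_const, ?_⟩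
    rw [← isClosed_compl_iff, hcompl]
    exact isClosed_eq (hπ t) continuous_const
  have key : ∀ s y z, π s y < π s z → ∃ U : Set K, IsClopen U ∧ y ∈ U ∧ z ∈ Uᶜ := by
    intro s y z hyz
    rcases hind s with hs | hs
    · have hall : ∀ y, π s y = 0 ∨ π s y = 1 := fun y =>
        he.induction_on y ((isClosed_eq (hπ s) continuous_const).union
          (isClosed_eq (hπ s) continuous_const)) hs
      refine ⟨_, (hcl s hs).compl, ?_, ?_⟩
      · rcases hall y with h | h
        · simp [h]
        · rcases hall z with h' | h' <;> simp [h, h'] at hyz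
          exact absurd hyz (by norm_num)
      · rcases hall z with h | h
        · rcases hall y with h' | h' <;> simp [h, h'] at hyz
          exact absurd hyz (by norm_num)
        · simp [h]
    · obtain ⟨p, hyp, hpz⟩ := EReal.lt_iff_exists_rat_btwn.1 hyz
      obtain ⟨q, hpq, hqz⟩ := EReal.lt_iff_exists_rat_btwn.1 hpz
      obtain ⟨t, ht⟩ := hs p q (by exact_mod_cast hpq)
      have hall : ∀ y, (π t y = 0 ∧ ((p : ℝ) : EReal) ≤ π s y) ∨
          (π t y = 1 ∧ π s y ≤ ((q : ℝ) : EReal)) := fun y =>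
        he.induction_on y
          (((isClosed_eq (hπ t) continuous_const).inter
            (isClosed_le continuous_const (hπ s))).union
          ((isClosed_eq (hπ t) continuous_const).inter
            (isClosed_le (hπ s) continuous_const))) ht
      refine ⟨_, hcl t fun x => (ht x).imp And.left And.left, ?_, ?_⟩
      · rcases hall y with h | h
        · exact absurd h.2 (not_le.2 hyp)
        · exact h.1
      · rcases hall z with h | h
        · simp [h.1]
        · exact absurd h.2 (not_le.2 hqz)
  refine totallySeparatedSpace_iff_exists_isClopen.2 fun y z hyz => ?_
  obtain ⟨s, hs⟩ : ∃ s, π s y ≠ π s z := by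
    by_contra! h
    exact hyz (hsep y z h)
  rcases lt_or_gt_of_ne hs with h | h
  · exact key s y z h
  · obtain ⟨U, hU, hz, hy⟩ := key s z y h
    exact ⟨Uᶜ, hU.compl, hy, by simpa using hz⟩

/-- In a space of covering dimension at most `0`, a countable family of continuous functions can be
enlarged to a countable family in which indicators separate the sublevel sets of its members. -/
theorem CovDimLE0.exists_countable_indicator {X : Type*} [TopologicalSpace X] (hX : CovDimLE0 X)
    {S : Set (X → ℝ)} (hS : S.Countable) (hSc : ∀ f ∈ S, Continuous f) :
    ∃ T : Set (X → ℝ), S ⊆ T ∧ T.Countable ∧ (∀ f ∈ T, Continuous f) ∧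
      ∀ f ∈ T, (∀ x, f x = 0 ∨ f x = 1) ∨
        ∀ p q : ℚ, p < q → ∃ g ∈ T, ∀ x, (g x = 0 ∧ p ≤ f x) ∨ (g x = 1 ∧ f x ≤ q) := by
  classical
  have : Countable S := hS
  have hC : ∀ (f : S) (p q : ℚ), ∃ C : Set X, IsClopen C ∧
      (p < q → (∀ x, f.1 x ≤ p → x ∈ C) ∧ ∀ x ∈ C, f.1 x < q) := by
    intro f p q
    by_cases hpq : p < q
    · obtain ⟨C, hC, h⟩ := hX.exists_isClopen_between (hSc f f.2)
        (show (p : ℝ) < q by exact_mod_cast hpq)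
      exact ⟨C, hC, fun _ => h⟩
    · exact ⟨∅, isClopen_empty, fun h => absurd h hpq⟩
  choose C hC hCpq using hC
  let g : S × ℚ × ℚ → X → ℝ := fun a => (C a.1 a.2.1 a.2.2).indicator 1
  refine ⟨S ∪ range g, subset_union_left, hS.union (countable_range g), ?_, ?_⟩
  · rintro f (hf | ⟨a, rfl⟩)
    · exact hSc f hf
    · exact (hC _ _ _).continuous_indicator_one
  · rintro f (hf | ⟨a, rfl⟩)
    · refine Or.inr fun p q hpq => ⟨g (⟨f, hf⟩, p, q), Or.inr (mem_range_self _), fun x => ?_⟩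
      obtain ⟨h₁, h₂⟩ := hCpq ⟨f, hf⟩ p q hpq
      by_cases hx : x ∈ C ⟨f, hf⟩ p q
      · exact Or.inr ⟨by simp [g, hx], (h₂ x hx).le⟩
      · exact Or.inl ⟨by simp [g, hx], (not_le.1 fun h => hx (h₁ x h)).le⟩
    · refine Or.inl fun x => ?_
      by_cases hx : x ∈ C a.1 a.2.1 a.2.2 <;> simp [g, hx]

theorem statement7 {X : Type u} [TopologicalSpace X] [MetrizableSpace X] [SeparableSpace X]
    (E : Set (X → ℝ)) (hEcount : E.Countable) (hEcont : ∀ f ∈ E, Continuous f) :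
    (∃ K : MetrizableCompactification X,
      ∀ f ∈ E, ∃ F : K.space → EReal, @Continuous K.space EReal K.top _ F ∧
        ∀ x, F (K.emb x) = (f x : EReal)) ∧
    (CovDimEq0 X →
      ∃ K : MetrizableCompactification X,
        @CovDimEq0 K.space K.top ∧
        ∀ f ∈ E, ∃ F : K.space → EReal, @Continuous K.space EReal K.top _ F ∧
          ∀ x, F (K.emb x) = (f x : EReal)) := by
  obtain ⟨S, hS, hSc, hSe⟩ := exists_countable_isEmbedding X
  have hcount : (S ∪ E).Countable := hS.union hEcount
  have hcont : ∀ f ∈ S ∪ E, Continuous f := fun f hf => hf.elim (hSc f) (hEcont f)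
  refine ⟨?_, fun hX => ?_⟩
  · obtain ⟨K, π, hπ, hπe, -⟩ := exists_metrizableCompactification_of_isEmbedding hcount
      (hSe.coe_ereal_of_subset subset_union_left hcont)
    exact ⟨K, fun f hf => ⟨π ⟨f, Or.inr hf⟩, hπ _, hπe _⟩⟩
  · obtain ⟨T, hST, hT, hTc, hind⟩ := hX.2.exists_countable_indicator hcount hcont
    obtain ⟨K, π, hπ, hπe, hsep⟩ := exists_metrizableCompactification_of_isEmbedding hT
      (hSe.coe_ereal_of_subset (subset_union_left.trans hST) hTc)
    let := K.top
    have := K.compact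
    have : TotallySeparatedSpace K.space := by
      refine totallySeparatedSpace_of_indicator K.denseRange hπ hsep fun s => ?_
      refine (hind s s.2).imp (fun h x => ?_) fun h p q hpq => ?_
      · rw [hπe]
        exact_mod_cast h x
      · obtain ⟨g, hg, hgx⟩ := h p q hpq
        refine ⟨⟨g, hg⟩, fun x => ?_⟩
        rw [hπe, hπe]
        exact_mod_cast hgx x
    exact ⟨K, ⟨hX.1.map K.emb, CovDimLE0.of_totallySeparatedSpace K.space⟩,
      fun f hf => ⟨π ⟨f, hST (Or.inr hf)⟩, hπ _, hπe _⟩⟩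
end
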